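/- arXiv:1109.1909 — 2 statements merged into one kernel-verified Lean document; each statement's English description precedes it below -/
import Mathlib

section
/- For every real number P0 > 0 there exist natural numbers n0' and p0, depending only on P0, with the following property. Let K ≥ 1, λ0 ≥ 0, and Ju : {1,…,K}×{1,…,K} → ℝ with 0 < Ju(i,j) ≤ exp(λ0) for all i,j. Let n0 ≥ n0', let p ≥ max(p0, n0), let τ ∈ [1/2, 1], and let W be a set of words of length n0 such that ∑_{α ∈ W} J_{n0}(α)^{1/2} ≤ exp(−n0·P0/2). Then ∑_{α ∈ Σ_p(W,τ)} J_p(α)^{1/2} ≤ exp(−p·P0/8 + p·(1−τ)·(λ0 + log K)) · (exp(λ0)·K)^{n0} · exp(n0·P0/2). -/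
open Finset

attribute [local instance] Classical.propDecidable

noncomputable section

/-- `Jword Ju α = ∏_{i=0}^{m-2} Ju (α i) (α (i+1))` (empty product for `m ≤ 1`). -/
def Jword {K m : ℕ} (Ju : Fin K → Fin K → ℝ) (α : Fin m → Fin K) : ℝ :=
  ∏ i : Fin (m - 1),
    Ju (α ⟨i.1, by have := i.2; omega⟩) (α ⟨i.1 + 1, by have := i.2; omega⟩)

/-- The window `(α_t, …, α_{t+n0-1})` of a word `α` of length `p` at position `t`. -/
def window {K : ℕ} (n0 : ℕ) {p : ℕ} (α : Fin p → Fin K) (t : ℕ) (ht : t + n0 ≤ p) :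
    Fin n0 → Fin K :=
  fun i => α ⟨t + i.1, by have := i.2; omega⟩

/-- The window of `α` at `j` is well defined and belongs to `W`. -/
def windowMem {K n0 p : ℕ} (W : Finset (Fin n0 → Fin K)) (α : Fin p → Fin K) (j : ℕ) : Prop :=
  ∃ h : j + n0 ≤ p, window n0 α j h ∈ W

/-- `Σ_p(W, τ)`: the set of words of length `p` such that the number of
`j ∈ {0,…,p−n0}` whose window at `j` belongs to `W` is at least `τ·(p−n0+1)`. -/
def SigmaSet {K : ℕ} (n0 p : ℕ) (W : Finset (Fin n0 → Fin K)) (τ : ℝ) :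
    Finset (Fin p → Fin K) :=
  Finset.univ.filter fun α =>
    τ * ((p : ℝ) - (n0 : ℝ) + 1) ≤
      (((Finset.range (p - n0 + 1)).filter (windowMem W α)).card : ℝ)

section WordSums

variable {K : ℕ}

/-- The number of positions of `α` whose window is not in `W`. -/
def badCount {n p : ℕ} (W : Finset (Fin n → Fin K)) (α : Fin p → Fin K) : ℕ :=
  ((Finset.range (p + 1 - n)).filter fun j => ¬ windowMem W α j).card

lemma windowMem_window {n p q s j : ℕ} (W : Finset (Fin n → Fin K)) (α : Fin p → Fin K)
    (hs : s + q ≤ p) (hj : j + n ≤ q) :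
    windowMem W (window q α s hs) j ↔ windowMem W α (s + j) := by
  have key : window n (window q α s hs) j hj = window n α (s + j) (by omega) := by
    funext i
    simp [window, Nat.add_assoc]
  constructor
  · rintro ⟨h, hw⟩
    exact ⟨by omega, key ▸ hw⟩
  · rintro ⟨h, hw⟩
    exact ⟨hj, key ▸ hw⟩

lemma badCount_window_le {n p q s : ℕ} (W : Finset (Fin n → Fin K)) (α : Fin p → Fin K)
    (hs : s + q ≤ p) : badCount W (window q α s hs) ≤ badCount W α := by
  refine Finset.card_le_card_of_injOn (fun j => s + j) ?_ fun a _ b _ h => by simpa using h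
  intro j hj
  simp only [Finset.coe_filter, Finset.mem_range, Set.mem_ofPred_eq] at hj ⊢
  exact ⟨by omega, fun h => hj.2 ((windowMem_window W α hs (by omega)).2 h)⟩

lemma badCount_window_one_lt {n p q : ℕ} (W : Finset (Fin n → Fin K)) (α : Fin p → Fin K)
    (hs : 1 + q ≤ p) (hn : n ≤ p) (h0 : ¬ windowMem W α 0) :
    badCount W (window q α 1 hs) < badCount W α := by
  have h0' : 0 ∈ (Finset.range (p + 1 - n)).filter fun j => ¬ windowMem W α j := by
    simp only [Finset.mem_filter, Finset.mem_range]
    exact ⟨by omega, h0⟩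
  refine lt_of_le_of_lt ?_ (Finset.card_erase_lt_of_mem h0')
  refine Finset.card_le_card_of_injOn (fun j => 1 + j) ?_ fun a _ b _ h => by simpa using h
  intro j hj
  simp only [Finset.coe_filter, Finset.mem_range, Set.mem_ofPred_eq, Finset.coe_erase,
    Set.mem_sdiff, Set.mem_singleton_iff] at hj ⊢
  exact ⟨⟨by omega, fun h => hj.2 ((windowMem_window W α hs (by omega)).2 h)⟩, by omega⟩

lemma Jword_nonneg {m : ℕ} {Ju : Fin K → Fin K → ℝ} (hJ : ∀ i j, 0 ≤ Ju i j)
    (α : Fin m → Fin K) : 0 ≤ Jword Ju α :=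
  Finset.prod_nonneg fun _ _ => hJ _ _

/-- Two windows sharing exactly one letter split the product defining `Jword`. -/
lemma Jword_split {s l : ℕ} (Ju : Fin K → Fin K → ℝ) (α : Fin (s + l + 1) → Fin K) :
    Jword Ju α = Jword Ju (window (s + 1) α 0 (by omega)) *
      Jword Ju (window (l + 1) α s (by omega)) := by
  refine (Fin.prod_univ_add (a := s) (b := l) _).trans ?_
  simp [Jword, window, Nat.add_assoc]

/-- Summing over words by splitting off an initial word in `V`, overlapping in one letter. -/
lemma sum_sqrt_Jword_le_mul {s l : ℕ} {Ju : Fin K → Fin K → ℝ} (hJ : ∀ i j, 0 ≤ Ju i j)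
    (V : Finset (Fin (s + 1) → Fin K)) (P : (Fin (s + l + 1) → Fin K) → Prop)
    (Q : (Fin (l + 1) → Fin K) → Prop) {_ : DecidablePred P} {_ : DecidablePred Q}
    (hV : ∀ α, P α → window (s + 1) α 0 (by omega) ∈ V)
    (hQ : ∀ α, P α → Q (window (l + 1) α s (by omega))) (D : ℝ)
    (hD : ∀ j, ∑ β with β 0 = j ∧ Q β, Real.sqrt (Jword Ju β) ≤ D) :
    ∑ α with P α, Real.sqrt (Jword Ju α) ≤ (∑ w ∈ V, Real.sqrt (Jword Ju w)) * D := by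
  let f : (Fin (s + l + 1) → Fin K) → (_ : Fin (s + 1) → Fin K) × (Fin (l + 1) → Fin K) :=
    fun α => ⟨window (s + 1) α 0 (by omega), window (l + 1) α s (by omega)⟩
  have hf : Function.Injective f := by
    intro α β h
    simp only [f, Sigma.mk.injEq, heq_eq_eq] at h
    funext i
    by_cases hi : i.1 < s + 1
    · simpa [window] using congrFun h.1 ⟨i.1, hi⟩
    · have := congrFun h.2 ⟨i.1 - s, by omega⟩
      have e : s + (i.1 - s) = i.1 := by omega
      simpa [window, e] using this
  let T : Finset ((_ : Fin (s + 1) → Fin K) × (Fin (l + 1) → Fin K)) :=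
    V.sigma fun w => Finset.univ.filter fun β => β 0 = w (Fin.last s) ∧ Q β
  calc ∑ α with P α, Real.sqrt (Jword Ju α)
      = ∑ x ∈ (Finset.univ.filter P).image f,
          Real.sqrt (Jword Ju x.1) * Real.sqrt (Jword Ju x.2) := by
        rw [Finset.sum_image hf.injOn]
        refine Finset.sum_congr rfl fun α _ => ?_
        rw [Jword_split, Real.sqrt_mul (Jword_nonneg hJ _)]
    _ ≤ ∑ x ∈ T, Real.sqrt (Jword Ju x.1) * Real.sqrt (Jword Ju x.2) := by
        refine Finset.sum_le_sum_of_subset_of_nonneg ?_ fun _ _ _ => by positivity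
        intro x hx
        obtain ⟨α, hα, rfl⟩ := Finset.mem_image.1 hx
        have hP : P α := (Finset.mem_filter.1 hα).2
        simp only [T, f, Finset.mem_sigma, Finset.mem_filter, Finset.mem_univ, true_and]
        exact ⟨hV α hP, by simp [window], hQ α hP⟩
    _ = ∑ w ∈ V, Real.sqrt (Jword Ju w) *
          ∑ β with β 0 = w (Fin.last s) ∧ Q β, Real.sqrt (Jword Ju β) := by
        rw [Finset.sum_sigma]
        simp only [Finset.mul_sum]
    _ ≤ ∑ w ∈ V, Real.sqrt (Jword Ju w) * D :=
        Finset.sum_le_sum fun w _ => mul_le_mul_of_nonneg_left (hD _) (Real.sqrt_nonneg _)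
    _ = _ := by rw [Finset.sum_mul]

lemma sum_sqrt_Jword_two_le {Ju : Fin K → Fin K → ℝ} {B : ℝ} (hB : 1 ≤ B)
    (hJB : ∀ i j, Ju i j ≤ B) (i : Fin K) :
    ∑ w : Fin (1 + 1) → Fin K with w 0 = i, Real.sqrt (Jword Ju w) ≤ B * K := by
  have hcard : ((Finset.univ.filter fun w : Fin (1 + 1) → Fin K => w 0 = i).card : ℝ) ≤ K := by
    have : (Finset.univ.filter fun w : Fin (1 + 1) → Fin K => w 0 = i).card
        ≤ (Finset.univ : Finset (Fin K)).card := by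
      refine Finset.card_le_card_of_injOn (fun w => w 1) (fun _ _ => by simp) ?_
      intro v hv w hw h
      simp only [Finset.coe_filter, Finset.mem_univ, true_and, Set.mem_ofPred_eq] at hv hw
      funext x
      fin_cases x
      · exact hv.trans hw.symm
      · exact h
    rw [Finset.card_univ, Fintype.card_fin] at this
    exact_mod_cast this
  have hterm : ∀ w : Fin (1 + 1) → Fin K, Real.sqrt (Jword Ju w) ≤ B := by
    intro w
    refine Real.sqrt_le_iff.2 ⟨by linarith, ?_⟩
    have : Jword Ju w = Ju (w 0) (w 1) := by
      refine (Fin.prod_univ_one _).trans ?_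
      rfl
    rw [this]
    nlinarith [hJB (w 0) (w 1)]
  calc _ ≤ (Finset.univ.filter fun w : Fin (1 + 1) → Fin K => w 0 = i).card • B :=
        Finset.sum_le_card_nsmul _ _ _ fun w _ => hterm w
    _ ≤ B * K := by
        rw [nsmul_eq_mul, mul_comm]
        exact mul_le_mul_of_nonneg_left hcard (by linarith)

lemma sum_sqrt_Jword_le_pow {Ju : Fin K → Fin K → ℝ} (hJ : ∀ i j, 0 ≤ Ju i j) {B : ℝ}
    (hB : 1 ≤ B) (hJB : ∀ i j, Ju i j ≤ B) (l : ℕ) (i : Fin K) :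
    ∑ α : Fin (l + 1) → Fin K with α 0 = i ∧ True, Real.sqrt (Jword Ju α) ≤ (B * K) ^ l := by
  induction l generalizing i with
  | zero =>
    have hone : ∀ α : Fin (0 + 1) → Fin K, Real.sqrt (Jword Ju α) = 1 := by
      intro α
      simp [Jword]
    have hcard : (Finset.univ.filter fun α : Fin (0 + 1) → Fin K => α 0 = i ∧ True).card ≤ 1 := by
      refine Finset.card_le_one.2 fun v hv w hw => ?_
      simp only [Finset.mem_filter, Finset.mem_univ, true_and, and_true] at hv hw
      funext x
      rw [Fin.fin_one_eq_zero x, hv, hw]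
    rw [Finset.sum_congr rfl fun α _ => hone α]
    simpa using hcard
  | succ l ih =>
    obtain ⟨k, hk⟩ : ∃ k, k = 1 + l := ⟨_, rfl⟩
    rw [show l + 1 = k by omega]
    subst hk
    have hBK : 0 ≤ (B * K) ^ l := by positivity
    calc _ ≤ (∑ w : Fin (1 + 1) → Fin K with w 0 = i, Real.sqrt (Jword Ju w)) * (B * K) ^ l := by
          refine sum_sqrt_Jword_le_mul (s := 1) (l := l) hJ _ _ (fun _ => True) ?_ (fun _ _ => trivial) _ ih
          rintro α ⟨h, -⟩
          simpa [window] using h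
      _ ≤ (B * K) * (B * K) ^ l :=
          mul_le_mul_of_nonneg_right (sum_sqrt_Jword_two_le hB hJB i) hBK
      _ = _ := by rw [add_comm 1 l, pow_succ']

/-- Exponential bound for the words with at most `b` windows outside `W`. The parameters `x`, `y`
are the gain per letter and the loss per bad window. -/
lemma sum_sqrt_Jword_badCount_le {m : ℕ} (hm : 1 ≤ m) {Ju : Fin K → Fin K → ℝ}
    (hJ : ∀ i j, 0 ≤ Ju i j) {B : ℝ} (hB : 1 ≤ B) (hJB : ∀ i j, Ju i j ≤ B) (hK : 1 ≤ K)
    (W : Finset (Fin (m + 1) → Fin K)) {ω x y : ℝ}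
    (hW : ∑ w ∈ W, Real.sqrt (Jword Ju w) ≤ ω) (hx : 0 ≤ x) (hy : 0 ≤ y)
    (hxy : ω * Real.exp (x * m) + Real.exp (x - y) ≤ 1) (l b : ℕ) (i : Fin K) :
    ∑ α : Fin (l + 1) → Fin K with α 0 = i ∧ badCount W α ≤ b, Real.sqrt (Jword Ju α) ≤
      (B * K) ^ (m + b) * Real.exp (x * m - x * l + y * b) := by
  have hK' : (1 : ℝ) ≤ K := by exact_mod_cast hK
  have hA : 1 ≤ B * K := by nlinarith
  induction l using Nat.strong_induction_on generalizing b i with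
  | _ l ih =>
  rcases lt_or_ge l m with hl | hl
  · calc _ ≤ ∑ α : Fin (l + 1) → Fin K with α 0 = i ∧ True, Real.sqrt (Jword Ju α) := by
          refine Finset.sum_le_sum_of_subset_of_nonneg ?_ fun _ _ _ => Real.sqrt_nonneg _
          intro α hα
          simp only [Finset.mem_filter, Finset.mem_univ, true_and, and_true] at hα ⊢
          exact hα.1
      _ ≤ (B * K) ^ l := sum_sqrt_Jword_le_pow hJ hB hJB l i
      _ ≤ (B * K) ^ (m + b) := pow_le_pow_right₀ hA (by omega)
      _ ≤ _ := by
          refine le_mul_of_one_le_right (by positivity) (Real.one_le_exp ?_)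
          have : (l : ℝ) ≤ m := by exact_mod_cast hl.le
          have := mul_le_mul_of_nonneg_left this hx
          have : 0 ≤ y * b := by positivity
          linarith
  · set R : ℝ := (B * K) ^ (m + b) * Real.exp (x * m - x * l + y * b) with hR
    have hRpos : 0 < R := by positivity
    have hgood : ∑ α : Fin (l + 1) → Fin K with
        (α 0 = i ∧ badCount W α ≤ b) ∧ windowMem W α 0, Real.sqrt (Jword Ju α) ≤
          ω * Real.exp (x * m) * R := by
      obtain ⟨k, rfl⟩ := Nat.exists_eq_add_of_le hl
      calc _ ≤ (∑ w ∈ W, Real.sqrt (Jword Ju w)) *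
            ((B * K) ^ (m + b) * Real.exp (x * m - x * k + y * b)) := by
            refine sum_sqrt_Jword_le_mul (s := m) (l := k) hJ _ _ (fun β => badCount W β ≤ b) ?_ ?_ _
              fun j => ih k (by omega) b j
            · rintro α ⟨-, _, h⟩
              exact h
            · rintro α ⟨⟨-, h⟩, -⟩
              exact (badCount_window_le W α _).trans h
        _ ≤ ω * ((B * K) ^ (m + b) * Real.exp (x * m - x * k + y * b)) :=
            mul_le_mul_of_nonneg_right hW (by positivity)
        _ = _ := by
            rw [hR, show x * m - x * k + y * b
              = x * m + (x * m - x * ((m + k : ℕ) : ℝ) + y * b) by push_cast; ring, Real.exp_add]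
            ring
    have hbad : ∑ α : Fin (l + 1) → Fin K with
        (α 0 = i ∧ badCount W α ≤ b) ∧ ¬ windowMem W α 0, Real.sqrt (Jword Ju α) ≤
          Real.exp (x - y) * R := by
      obtain ⟨k, rfl⟩ := Nat.exists_eq_add_of_le (hm.trans hl)
      rcases b with _ | b
      · rw [Finset.sum_eq_zero]
        · positivity
        · intro α hα
          simp only [Finset.mem_filter, Finset.mem_univ, true_and] at hα
          have := badCount_window_one_lt (q := k) W α (by omega) (by omega) hα.2
          omega
      · calc _ ≤ (∑ w : Fin (1 + 1) → Fin K with w 0 = i, Real.sqrt (Jword Ju w)) *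
              ((B * K) ^ (m + b) * Real.exp (x * m - x * k + y * b)) := by
              refine sum_sqrt_Jword_le_mul (s := 1) (l := k) hJ _ _ (fun β => badCount W β ≤ b) ?_ ?_ _
                fun j => ih k (by omega) b j
              · rintro α ⟨⟨h, -⟩, -⟩
                simpa [window] using h
              · rintro α ⟨⟨-, h⟩, h0⟩
                have := badCount_window_one_lt (q := k + 1) W α (by omega) (by omega) h0
                omega
          _ ≤ (B * K) * ((B * K) ^ (m + b) * Real.exp (x * m - x * k + y * b)) :=
              mul_le_mul_of_nonneg_right (sum_sqrt_Jword_two_le hB hJB i) (by positivity)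
          _ = _ := by
              rw [hR, show x * m - x * k + y * b = (x - y) +
                (x * m - x * ((1 + k : ℕ) : ℝ) + y * ((b + 1 : ℕ) : ℝ)) by push_cast; ring,
                Real.exp_add]
              ring
    have hsplit := Finset.sum_filter_add_sum_filter_not
      (Finset.univ.filter fun α : Fin (l + 1) → Fin K => α 0 = i ∧ badCount W α ≤ b)
      (fun α => windowMem W α 0) fun α => Real.sqrt (Jword Ju α)
    rw [Finset.filter_filter, Finset.filter_filter] at hsplit
    rw [← hsplit]
    calc _ ≤ ω * Real.exp (x * m) * R + Real.exp (x - y) * R := add_le_add hgood hbad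
      _ = (ω * Real.exp (x * m) + Real.exp (x - y)) * R := by ring
      _ ≤ 1 * R := mul_le_mul_of_nonneg_right hxy hRpos.le
      _ = R := one_mul R

lemma badCount_le_of_mem_SigmaSet {n p : ℕ} (hnp : n ≤ p) {W : Finset (Fin n → Fin K)} {τ : ℝ}
    {α : Fin p → Fin K} (hα : α ∈ SigmaSet n p W τ) :
    (badCount W α : ℝ) ≤ (1 - τ) * ((p : ℝ) - n + 1) := by
  have h := (Finset.mem_filter.1 hα).2
  have hcard := Finset.card_filter_add_card_filter_not (s := Finset.range (p - n + 1))
    (windowMem W α)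
  have hb : badCount W α =
      ((Finset.range (p - n + 1)).filter fun j => ¬ windowMem W α j).card := by
    rw [badCount, show p + 1 - n = p - n + 1 by omega]
  rw [← hb, Finset.card_range] at hcard
  have hcard' : (((Finset.range (p - n + 1)).filter (windowMem W α)).card : ℝ) + badCount W α
      = (p : ℝ) - n + 1 := by
    rw [← Nat.cast_sub hnp]
    exact_mod_cast hcard
  linarith

end WordSums

theorem stmt0 (P0 : ℝ) (hP0 : 0 < P0) :
    ∃ n0' p0 : ℕ,
      ∀ (K : ℕ), 1 ≤ K →
      ∀ (lam0 : ℝ), 0 ≤ lam0 →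
      ∀ (Ju : Fin K → Fin K → ℝ),
        (∀ i j, 0 < Ju i j ∧ Ju i j ≤ Real.exp lam0) →
      ∀ (n0 : ℕ), n0' ≤ n0 →
      ∀ (p : ℕ), p0 ≤ p → n0 ≤ p →
      ∀ (τ : ℝ), 1 / 2 ≤ τ → τ ≤ 1 →
      ∀ (W : Finset (Fin n0 → Fin K)),
        (∑ α ∈ W, Real.sqrt (Jword Ju α)) ≤ Real.exp (-((n0 : ℝ) * P0 / 2)) →
        (∑ α ∈ SigmaSet n0 p W τ, Real.sqrt (Jword Ju α)) ≤
          Real.exp (-((p : ℝ) * P0 / 8) + (p : ℝ) * (1 - τ) * (lam0 + Real.log K)) *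
            (Real.exp lam0 * (K : ℝ)) ^ n0 * Real.exp ((n0 : ℝ) * P0 / 2) := by
  obtain ⟨N, hN⟩ : ∃ N : ℕ, Real.exp (-((N : ℝ) * (P0 / 8))) ≤ 1 - Real.exp (-(P0 / 8)) := by
    have hr : Real.exp (-(P0 / 8)) < 1 := Real.exp_lt_one_iff.2 (by linarith)
    obtain ⟨N, hN⟩ := exists_pow_lt_of_lt_one (sub_pos.2 hr) hr
    refine ⟨N, ?_⟩
    rw [← mul_neg, Real.exp_nat_mul]
    exact hN.le
  refine ⟨N + 2, 0, ?_⟩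
  intro K hK lam0 hlam Ju hJu n0 hn0 p _ hnp τ hτ hτ1 W hW
  obtain ⟨m, rfl⟩ : ∃ m, n0 = m + 1 := ⟨n0 - 1, by omega⟩
  obtain ⟨l, rfl⟩ : ∃ l, p = l + 1 := ⟨p - 1, by omega⟩
  have hB : 1 ≤ Real.exp lam0 := Real.one_le_exp hlam
  have hK' : (1 : ℝ) ≤ K := by exact_mod_cast hK
  have hlogK : 0 ≤ Real.log K := Real.log_nonneg hK'
  set A : ℝ := Real.exp lam0 * K with hA
  have hAexp : A = Real.exp (lam0 + Real.log K) := by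
    rw [hA, Real.exp_add, Real.exp_log (by linarith)]
  have hA0 : 0 < A := hAexp ▸ Real.exp_pos _
  have hKA : (K : ℝ) ≤ A := by nlinarith
  have hml : (m : ℝ) ≤ l := by exact_mod_cast Nat.le_of_succ_le_succ hnp
  have hm0 : (0 : ℝ) ≤ m := Nat.cast_nonneg m
  set b : ℕ := ⌊(1 - τ) * (((l + 1 : ℕ) : ℝ) - ((m + 1 : ℕ) : ℝ) + 1)⌋₊ with hb
  have hb' : (b : ℝ) ≤ (1 - τ) * ((l : ℝ) + 1) := by
    refine (Nat.floor_le ?_).trans ?_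
    · push_cast
      exact mul_nonneg (by linarith) (by linarith)
    · push_cast
      exact mul_le_mul_of_nonneg_left (by linarith) (by linarith)
  have hxy : Real.exp (-(((m + 1 : ℕ) : ℝ) * P0 / 2)) * Real.exp (3 * P0 / 8 * m) +
      Real.exp (3 * P0 / 8 - P0 / 2) ≤ 1 := by
    rw [← Real.exp_add, show 3 * P0 / 8 - P0 / 2 = -(P0 / 8) by ring]
    have hNm : (N : ℝ) ≤ m := by exact_mod_cast (by omega : N ≤ m)
    have := mul_le_mul_of_nonneg_right hNm (by linarith : 0 ≤ P0 / 8)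
    have : Real.exp (-(((m + 1 : ℕ) : ℝ) * P0 / 2) + 3 * P0 / 8 * m) ≤
        Real.exp (-((N : ℝ) * (P0 / 8))) := by
      refine Real.exp_le_exp.2 ?_
      push_cast
      linarith
    linarith
  have hmain := fun i : Fin K => sum_sqrt_Jword_badCount_le (by omega) (fun i j => (hJu i j).1.le)
    hB (fun i j => (hJu i j).2) hK W hW (by positivity) (by positivity) hxy l b i
  calc ∑ α ∈ SigmaSet (m + 1) (l + 1) W τ, Real.sqrt (Jword Ju α)
      ≤ ∑ α : Fin (l + 1) → Fin K with badCount W α ≤ b, Real.sqrt (Jword Ju α) := by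
        refine Finset.sum_le_sum_of_subset_of_nonneg ?_ fun _ _ _ => Real.sqrt_nonneg _
        intro α hα
        simp only [Finset.mem_filter, Finset.mem_univ, true_and]
        exact Nat.le_floor (badCount_le_of_mem_SigmaSet hnp hα)
    _ = ∑ i : Fin K, ∑ α : Fin (l + 1) → Fin K with α 0 = i ∧ badCount W α ≤ b,
          Real.sqrt (Jword Ju α) := by
        rw [← Finset.sum_fiberwise _ fun α : Fin (l + 1) → Fin K => α 0]
        refine Finset.sum_congr rfl fun i _ => Finset.sum_congr ?_ fun _ _ => rfl
        ext α
        simp [and_comm]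
    _ ≤ K * (A ^ (m + b) * Real.exp (3 * P0 / 8 * m - 3 * P0 / 8 * l + P0 / 2 * b)) := by
        refine (Finset.sum_le_card_nsmul _ _ _ fun i _ => hmain i).trans_eq ?_
        rw [Finset.card_univ, Fintype.card_fin, nsmul_eq_mul]
    _ ≤ A * (A ^ (m + b) * Real.exp (3 * P0 / 8 * m - 3 * P0 / 8 * l + P0 / 2 * b)) :=
        mul_le_mul_of_nonneg_right hKA (by positivity)
    _ = Real.exp (b * (lam0 + Real.log K) + (3 * P0 / 8 * m - 3 * P0 / 8 * l + P0 / 2 * b)) *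
          A ^ (m + 1) := by
        rw [Real.exp_add _ (_ - _ + _), Real.exp_nat_mul, ← hAexp]
        ring
    _ ≤ Real.exp (-(((l + 1 : ℕ) : ℝ) * P0 / 8) +
            ((l + 1 : ℕ) : ℝ) * (1 - τ) * (lam0 + Real.log K) + ((m + 1 : ℕ) : ℝ) * P0 / 2) *
          A ^ (m + 1) := by
        refine mul_le_mul_of_nonneg_right (Real.exp_le_exp.2 ?_) (by positivity)
        have h1 := mul_le_mul_of_nonneg_right hb' (by linarith : 0 ≤ lam0 + Real.log K)
        have h2 : (b : ℝ) ≤ ((l : ℝ) + 1) / 2 := by nlinarith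
        have h3 := mul_le_mul_of_nonneg_left h2 (by linarith : 0 ≤ P0 / 2)
        have h4 : 0 ≤ P0 * m := by positivity
        push_cast
        linarith
    _ = _ := by
        rw [Real.exp_add _ (_ / 2)]
        ring

end
end

section
/- Let K ≥ 1 and n0 ≥ 1 be integers, let λ0 ≥ 0, and let Ju : {1,…,K}×{1,…,K} → ℝ satisfy 0 < Ju(i,j) ≤ exp(λ0) for all i,j. Let p ≥ n0, let α be a word of length p, and let T ⊆ {0,…,p−n0} be a finite set whose distinct elements differ by at least n0. Then J_p(α)^{1/2} ≤ exp(λ0 · (p − 1 − (card T)·(n0 − 1))) · ∏_{t ∈ T} J_{n0}(window of α at t)^{1/2}. -/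
open Finset

noncomputable section

/-- The weight of the `i`-th transition of `α`, extended by `1` past the end of the word. -/
def transitionWeight {K p : ℕ} (Ju : Fin K → Fin K → ℝ) (α : Fin p → Fin K) (i : ℕ) : ℝ :=
  if h : i + 1 < p then Ju (α ⟨i, by omega⟩) (α ⟨i + 1, h⟩) else 1

lemma Jword_eq_prod_range {K p : ℕ} (Ju : Fin K → Fin K → ℝ) (α : Fin p → Fin K) :
    Jword Ju α = ∏ i ∈ range (p - 1), transitionWeight Ju α i := by
  rw [Jword, Finset.prod_range]
  refine Finset.prod_congr rfl fun i _ => ?_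
  have := i.2
  rw [transitionWeight, dif_pos (by omega)]

lemma Jword_window_eq_prod_Ico {K p n0 : ℕ} (Ju : Fin K → Fin K → ℝ) (α : Fin p → Fin K)
    (t : ℕ) (ht : t + n0 ≤ p) :
    Jword Ju (window n0 α t ht) = ∏ i ∈ Ico t (t + (n0 - 1)), transitionWeight Ju α i := by
  rw [Jword, Finset.prod_Ico_eq_prod_range, Nat.add_sub_cancel_left, Finset.prod_range]
  refine Finset.prod_congr rfl fun i _ => ?_
  have := i.2
  rw [transitionWeight, dif_pos (by omega)]
  rfl

/-- If the factors of a product over `s` lie in `[0, exp c]` with `c ≥ 0`, the factors outside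
`u ⊆ s` contribute at most `exp (c * (#s - #u))`, even after taking square roots. -/
lemma sqrt_prod_le_exp_mul_sqrt_prod {ι : Type*} [DecidableEq ι] {f : ι → ℝ} {c : ℝ}
    (hc : 0 ≤ c) (hf : ∀ i, 0 ≤ f i) (hfc : ∀ i, f i ≤ Real.exp c) {s u : Finset ι}
    (hus : u ⊆ s) :
    Real.sqrt (∏ i ∈ s, f i) ≤
      Real.exp (c * ((s.card : ℝ) - u.card)) * Real.sqrt (∏ i ∈ u, f i) := by
  have hcard : ((s \ u).card : ℝ) = (s.card : ℝ) - u.card := Finset.cast_card_sdiff hus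
  have hrest : ∏ i ∈ s \ u, f i ≤ Real.exp (c * ((s.card : ℝ) - u.card)) := by
    rw [← hcard, mul_comm, Real.exp_nat_mul]
    exact (Finset.prod_le_prod (fun i _ => hf i) fun i _ => hfc i).trans_eq
      (Finset.prod_const _)
  have hone : 1 ≤ Real.exp (c * ((s.card : ℝ) - u.card)) :=
    Real.one_le_exp (by rw [← hcard]; positivity)
  rw [← Finset.prod_sdiff hus, Real.sqrt_mul (Finset.prod_nonneg fun i _ => hf i)]
  gcongr
  rw [Real.sqrt_le_left (by positivity)]
  nlinarith

theorem stmt2 {K n0 : ℕ} (hK : 1 ≤ K) (hn0 : 1 ≤ n0) (lam0 : ℝ) (hlam0 : 0 ≤ lam0)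
    (Ju : Fin K → Fin K → ℝ) (hJu : ∀ i j, 0 < Ju i j ∧ Ju i j ≤ Real.exp lam0)
    {p : ℕ} (hp : n0 ≤ p) (α : Fin p → Fin K) (T : Finset ℕ)
    (hT : ∀ t ∈ T, t ≤ p - n0)
    (hsep : ∀ t ∈ T, ∀ t' ∈ T, t ≠ t' → (n0 : ℤ) ≤ |(t : ℤ) - (t' : ℤ)|) :
    Real.sqrt (Jword Ju α) ≤
      Real.exp (lam0 * ((p : ℝ) - 1 - (T.card : ℝ) * ((n0 : ℝ) - 1))) *
        ∏ t ∈ T.attach,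
          Real.sqrt (Jword Ju (window n0 α t.1 (by have h1 := hT t.1 t.2; omega))) := by
  set f := transitionWeight Ju α with hf_def
  have hf : ∀ i, 0 ≤ f i := fun i => by
    rw [hf_def, transitionWeight]
    split_ifs
    · exact (hJu _ _).1.le
    · exact zero_le_one
  have hfc : ∀ i, f i ≤ Real.exp lam0 := fun i => by
    rw [hf_def, transitionWeight]
    split_ifs
    · exact (hJu _ _).2
    · exact Real.one_le_exp hlam0
  have hdisj : (T : Set ℕ).PairwiseDisjoint fun t => Ico t (t + (n0 - 1)) := by
    intro t ht t' ht' hne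
    have habs := hsep t ht t' ht' hne
    refine Finset.disjoint_left.2 fun i hi hi' => ?_
    simp only [Finset.mem_Ico] at hi hi'
    rcases le_abs.1 habs with h | h <;> omega
  have hsub : T.biUnion (fun t => Ico t (t + (n0 - 1))) ⊆ range (p - 1) := by
    refine Finset.biUnion_subset.2 fun t ht i hi => ?_
    have := hT t ht
    simp only [Finset.mem_Ico] at hi
    simp only [Finset.mem_range]
    omega
  have hbound := sqrt_prod_le_exp_mul_sqrt_prod hlam0 hf hfc hsub
  rw [Finset.prod_biUnion hdisj, Finset.card_biUnion hdisj] at hbound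
  simp only [Nat.card_Ico, Nat.add_sub_cancel_left, Finset.sum_const, smul_eq_mul,
    Finset.card_range, Nat.cast_mul, Nat.cast_sub hn0, Nat.cast_sub (hn0.trans hp),
    Nat.cast_one] at hbound
  simp only [Jword_eq_prod_range Ju α, Jword_window_eq_prod_Ico]
  rw [Finset.prod_attach T fun t => Real.sqrt (∏ i ∈ Ico t (t + (n0 - 1)), f i),
    ← Real.sqrt_prod T fun t _ => Finset.prod_nonneg fun i _ => hf i]
  exact hbound

end
end
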